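/- For every integer g ≥ 2 there exist an integer d ≥ 1 and permutations σ_a, σ_b of a d-element set such that: (i) the subgroup of the symmetric group generated by σ_a and σ_b acts transitively; (ii) if c denotes the number of orbits (cycles, counting fixed points) of the commutator σ_a·σ_b·σ_a⁻¹·σ_b⁻¹, then d − c = 2g − 2 (so the closed origami surface defined by the pair (σ_a, σ_b) has genus g); and (iii) the Veech group Γ(U) of the stabilizer subgroup U = {w ∈ F₂ : m(w)(1) = 1}, where m : F₂ → S_d is the homomorphism with m(x) = σ_a and m(y) = σ_b, is not a congruence subgroup of SL₂(ℤ). -/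

import Mathlib

/-- The free group on two generators. -/
abbrev F2 := FreeGroup (Fin 2)

/-- The generator `x` of `F₂`. -/
def xg : F2 := FreeGroup.of 0

/-- The generator `y` of `F₂`. -/
def yg : F2 := FreeGroup.of 1

/-- The exponent sum of the `i`-th generator, i.e. the `i`-th coordinate of the image in the
abelianization `ℤ²` of `F₂`. -/
def expSum (i : Fin 2) : F2 →* Multiplicative ℤ :=
  FreeGroup.lift fun j => Multiplicative.ofAdd (if j = i then (1 : ℤ) else 0)

/-- The matrix in `GL₂(ℤ)` induced by an automorphism `γ` of `F₂` on the abelianization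
`F₂^ab ≅ ℤ²` (with basis the images of `x` and `y`); i.e. `β̂(γ)`. -/
def autMat (γ : F2 ≃* F2) : Matrix (Fin 2) (Fin 2) ℤ :=
  Matrix.of fun i j => Multiplicative.toAdd (expSum i (γ (FreeGroup.of j)))

abbrev SL2Z := Matrix.SpecialLinearGroup (Fin 2) ℤ

/-- `Stab(V) = {γ ∈ Aut⁺(F₂) : γ(V) = V}`. -/
def StabSet (V : Subgroup F2) : Set (F2 ≃* F2) :=
  { γ | (autMat γ).det = 1 ∧ Subgroup.map γ.toMonoidHom V = V }

/-- The Veech group `Γ(V) = β̂(Stab(V)) ⊆ SL₂(ℤ)` of a subgroup `V` of `F₂`. -/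
def VeechGroup (V : Subgroup F2) : Set SL2Z :=
  { A | ∃ γ : F2 ≃* F2, γ ∈ StabSet V ∧ (A : Matrix (Fin 2) (Fin 2) ℤ) = autMat γ }

/-- A set of elements of `SL₂(ℤ)` is a congruence group if it contains the principal congruence
subgroup `Γ(n)` for some `n ≥ 1`. -/
def IsCongruenceSet (S : Set SL2Z) : Prop :=
  ∃ n : ℕ, 1 ≤ n ∧ (CongruenceSubgroup.Gamma n : Set SL2Z) ⊆ S

/-- The subgroup of `Multiplicative ℤ` of elements divisible by `n`. -/
def divSub (n : ℤ) : Subgroup (Multiplicative ℤ) where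
  carrier := {d | n ∣ Multiplicative.toAdd d}
  one_mem' := dvd_zero n
  mul_mem' := fun ha hb => dvd_add ha hb
  inv_mem' := fun ha => dvd_neg.mpr ha

/-- The subgroup `Hₙ = {u ∈ U : n ∣ α(u)}` of `F₂` (for `n = 0` this is `ker α = H₀`). -/
def Hgrp {U : Subgroup F2} (α : U →* Multiplicative ℤ) (n : ℕ) : Subgroup F2 :=
  Subgroup.map U.subtype (Subgroup.comap α (divSub (n : ℤ)))

/-- The subgroup `U_L` of `F₂` corresponding to the origami `L(2,3)`. -/
def UL : Subgroup F2 :=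
  Subgroup.closure {xg ^ 3, xg * yg * xg⁻¹, xg ^ 2 * yg * (xg ^ 2)⁻¹, yg * xg * yg⁻¹, yg ^ 2}

/-- The subgroup `U_D` of `F₂` corresponding to the origami `D`. -/
def UD : Subgroup F2 :=
  Subgroup.closure {xg ^ 3, xg * yg * (xg ^ 2)⁻¹, xg ^ 2 * yg * xg⁻¹, yg * xg * yg⁻¹,
    yg ^ 2 * xg * (yg ^ 2)⁻¹, yg ^ 3}

section CommonPrefix

variable {α : Type*} [DecidableEq α]

/-- The length of the longest common prefix of two lists. -/
def commonPrefixLength {β : Type*} [DecidableEq β] : List β → List β → ℕ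
  | a :: l, b :: l' => if a = b then commonPrefixLength l l' + 1 else 0
  | _, _ => 0

theorem commonPrefixLength_comm {β : Type*} [DecidableEq β] (l l' : List β) :
    commonPrefixLength l l' = commonPrefixLength l' l := by
  induction l generalizing l' with
  | nil => cases l' <;> simp [commonPrefixLength]
  | cons a l ih =>
    cases l' with
    | nil => simp [commonPrefixLength]
    | cons b l' => simp [commonPrefixLength, ih l', eq_comm]

theorem min_commonPrefixLength_le {β : Type*} [DecidableEq β] (l₁ l₂ l₃ : List β) :
    min (commonPrefixLength l₁ l₂) (commonPrefixLength l₂ l₃) ≤ commonPrefixLength l₁ l₃ := by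
  induction l₁ generalizing l₂ l₃ with
  | nil => simp [commonPrefixLength]
  | cons a l₁ ih =>
    cases l₂ with
    | nil => simp [commonPrefixLength]
    | cons b l₂ =>
      cases l₃ with
      | nil => simp [commonPrefixLength]
      | cons c l₃ =>
        have := ih l₂ l₃
        simp only [commonPrefixLength]
        grind

theorem commonPrefixLength_take {β : Type*} [DecidableEq β] (l : List β) (k : ℕ)
    (hk : k ≤ l.length) : commonPrefixLength l (l.take k) = k := by
  induction l generalizing k with
  | nil => simp_all [commonPrefixLength]
  | cons a l ih =>
    cases k with
    | zero => simp [commonPrefixLength]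
    | succ k => simpa [commonPrefixLength] using ih k (by simpa using hk)

theorem exists_eq_append_commonPrefix {β : Type*} [DecidableEq β] (l l' : List β) :
    ∃ p a b : List β, l = p ++ a ∧ l' = p ++ b ∧ p.length = commonPrefixLength l l' ∧
      ∀ x ∈ a.head?, ∀ y ∈ b.head?, x ≠ y := by
  induction l generalizing l' with
  | nil => exact ⟨[], [], l', by simp [commonPrefixLength]⟩
  | cons c l ih =>
    cases l' with
    | nil => exact ⟨[], c :: l, [], by simp [commonPrefixLength]⟩
    | cons d l' =>
      by_cases h : c = d
      · obtain ⟨p, a, b, h1, h2, h3, h4⟩ := ih l'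
        exact ⟨c :: p, a, b, by simp [h1], by simp [h2, h], by simp [h3, commonPrefixLength, h], h4⟩
      · exact ⟨[], c :: l, d :: l', by simp [commonPrefixLength, h]⟩

namespace FreeGroup

/-- The length of the longest common prefix of the reduced words of two elements of a free group,
i.e. their Gromov product in the Cayley tree. -/
def gromov (g h : FreeGroup α) : ℕ := commonPrefixLength g.toWord h.toWord

theorem gromov_comm (g h : FreeGroup α) : gromov g h = gromov h g := commonPrefixLength_comm _ _

theorem min_gromov_le (g h k : FreeGroup α) : min (gromov g h) (gromov h k) ≤ gromov g k :=
  min_commonPrefixLength_le _ _ _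

theorem norm_inv_mul_add (g h : FreeGroup α) :
    norm (g⁻¹ * h) + 2 * gromov g h = norm g + norm h := by
  obtain ⟨p, a, b, h1, h2, h3, h4⟩ := exists_eq_append_commonPrefix g.toWord h.toWord
  have hg : g = mk p * mk a := by rw [← mul_mk.symm, ← h1, mk_toWord]
  have hh : h = mk p * mk b := by rw [← mul_mk.symm, ← h2, mk_toWord]
  have hmul : g⁻¹ * h = mk (invRev a ++ b) := by
    rw [hg, hh, ← mul_mk, ← inv_mk]; group
  have ha : IsReduced a := (isReduced_toWord (x := g)).infix ⟨p, [], by simp [h1]⟩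
  have hb : IsReduced b := (isReduced_toWord (x := h)).infix ⟨p, [], by simp [h2]⟩
  have ha' : IsReduced (invRev a) := by
    rw [isReduced_iff_reduce_eq, reduce_invRev, ha.reduce_eq]
  have hred : IsReduced (invRev a ++ b) := by
    refine List.isChain_append.2 ⟨ha', hb, ?_⟩
    intro x hx y hy hxy
    cases a with
    | nil => simp [invRev] at hx
    | cons c a =>
      simp only [invRev, List.map_cons, List.reverse_cons, List.getLast?_append,
        List.getLast?_singleton, Option.some_or, Option.mem_def, Option.some.injEq] at hx
      have := h4 c (by simp) y hy
      subst hx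
      rcases c with ⟨c, e⟩
      rcases y with ⟨y, e'⟩
      simp only at hxy
      subst hxy
      cases e <;> cases e' <;> simp_all
  have hn : norm (g⁻¹ * h) = a.length + b.length := by
    rw [hmul, norm, toWord_mk, hred.reduce_eq]; simp
  have hg' : norm g = p.length + a.length := by rw [norm, h1]; simp
  have hh' : norm h = p.length + b.length := by rw [norm, h2]; simp
  have : gromov g h = p.length := h3.symm
  omega

theorem exists_norm_eq_gromov_eq (g : FreeGroup α) (k : ℕ) (hk : k ≤ norm g) :
    ∃ q : FreeGroup α, norm q = k ∧ gromov g q = k := by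
  have hred : (mk (g.toWord.take k)).toWord = g.toWord.take k := by
    rw [toWord_mk]
    exact (isReduced_toWord.infix (List.take_prefix _ _).isInfix).reduce_eq
  refine ⟨mk (g.toWord.take k), ?_, ?_⟩
  · rw [norm, hred, List.length_take]; exact min_eq_left hk
  · rw [gromov, hred]; exact commonPrefixLength_take _ _ hk

theorem gromov_le_left (g h : FreeGroup α) : gromov g h ≤ norm g := by
  have h1 := norm_inv_mul_add g h
  have h2 := norm_mul_le g (g⁻¹ * h)
  rw [mul_inv_cancel_left] at h2
  omega

theorem gromov_le_right (g h : FreeGroup α) : gromov g h ≤ norm h := by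
  rw [gromov_comm]; exact gromov_le_left h g

theorem norm_mul_add (g h : FreeGroup α) :
    norm (g * h) + 2 * gromov g⁻¹ h = norm g + norm h := by
  simpa [norm_inv_eq] using norm_inv_mul_add g⁻¹ h

theorem gromov_mul_left (g h : FreeGroup α) : gromov (g * h) g + gromov g⁻¹ h = norm g := by
  have h1 := norm_inv_mul_add g (g * h)
  have h2 := norm_mul_add g h
  rw [inv_mul_cancel_left, gromov_comm] at h1
  omega

/-- Conjugating by a common prefix of `g` and `g⁻¹` shortens `g`. -/
theorem norm_conj_of_gromov_eq {g q : FreeGroup α} (h1 : gromov g q = norm q)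
    (h2 : gromov g⁻¹ q = norm q) (hq : 2 * norm q ≤ norm g) :
    norm (q⁻¹ * g * q) + 2 * norm q = norm g := by
  have e1 := norm_inv_mul_add g q
  have e2 := gromov_mul_left g⁻¹ q
  rw [inv_inv, norm_inv_eq] at e2
  have e3 := min_gromov_le (g⁻¹ * q) g⁻¹ q
  have e4 := norm_inv_mul_add (g⁻¹ * q) q
  have e5 := gromov_le_right (g⁻¹ * q) q
  have : (g⁻¹ * q)⁻¹ * q = q⁻¹ * g * q := by group
  rw [this] at e4
  omega

theorem gromov_eq_of_le {g h q : FreeGroup α} (h1 : gromov g q = norm q) (h2 : norm q ≤ gromov g h) :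
    gromov h q = norm q := by
  have := min_gromov_le h g q
  have := gromov_le_right h q
  rw [gromov_comm h g] at *
  omega

theorem two_mul_gromov_inv_lt {g : FreeGroup α} (hg : g ≠ 1) : 2 * gromov g g⁻¹ < norm g := by
  by_contra! hcon
  have hpos : norm g ≠ 0 := by simpa [norm_eq_zero] using hg
  obtain ⟨q, hq1, hq2⟩ := exists_norm_eq_gromov_eq g (norm g / 2) (by omega)
  have hq2' : gromov g q = norm q := by rw [hq1, hq2]
  have hc := norm_conj_of_gromov_eq hq2' (gromov_eq_of_le hq2' (by omega)) (by omega)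
  set s := q⁻¹ * g * q with hs
  have hgs : g = q * s * q⁻¹ := by rw [hs]; group
  have hs1 : s ≠ 1 := by
    rintro h
    rw [h] at hgs
    exact hg (by simpa using hgs)
  have hodd : norm s ≠ 0 := by simpa [norm_eq_zero] using hs1
  have key : ∀ t : FreeGroup α, q * t * q⁻¹ = g ∨ q * t * q⁻¹ = g⁻¹ → norm t = 1 →
      gromov (q * t * q⁻¹) (q * t) = norm q + 1 ∧ norm (q * t) = norm q + 1 := by
    intro t ht ht1
    have e1 := norm_mul_le q t
    have e2 := norm_mul_le (q * t) q⁻¹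
    have e3 := norm_inv_mul_add (q * t * q⁻¹) (q * t)
    have e4 : (q * t * q⁻¹)⁻¹ * (q * t) = q := by group
    have e5 : norm (q * t * q⁻¹) = norm g := by
      rcases ht with h | h <;> rw [h]
      exact norm_inv_eq
    rw [norm_inv_eq] at e2
    rw [e4] at e3
    omega
  have hgs' : g⁻¹ = q * s⁻¹ * q⁻¹ := by rw [hgs]; group
  have k1 := key s (Or.inl hgs.symm) (by omega)
  have k2 := key s⁻¹ (Or.inr hgs'.symm) (by rw [norm_inv_eq]; omega)
  rw [← hgs] at k1
  rw [← hgs'] at k2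
  have m1 := min_gromov_le (q * s) g g⁻¹
  have m2 := min_gromov_le (q * s) g⁻¹ (q * s⁻¹)
  have e := norm_inv_mul_add (q * s) (q * s⁻¹)
  have e' : (q * s)⁻¹ * (q * s⁻¹) = (s ^ 2)⁻¹ := by group
  rw [e', norm_inv_eq] at e
  rw [gromov_comm (q * s) g] at m1
  have : s ^ 2 = 1 := by rw [← norm_eq_zero]; omega
  exact hs1 ((pow_eq_one_iff.1 this).resolve_right two_ne_zero)

end FreeGroup

end CommonPrefix

/-- The element of `F₂` given by a one-letter word. -/
def letter (a : Fin 2 × Bool) : F2 := FreeGroup.mk [a]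

theorem norm_letter (a : Fin 2 × Bool) : (letter a).norm = 1 := by
  simp [letter, FreeGroup.norm, FreeGroup.toWord_mk]

theorem exists_eq_letter {g : F2} (hg : g.norm = 1) : ∃ a, g = letter a := by
  obtain ⟨a, ha⟩ := List.length_eq_one_iff.1 hg
  exact ⟨a, by rw [letter, ← ha, FreeGroup.mk_toWord]⟩

theorem letter_inv (a : Fin 2 × Bool) : (letter a)⁻¹ = letter (a.1, !a.2) := by
  simp [letter, FreeGroup.inv_mk, FreeGroup.invRev]

theorem letter_true (i : Fin 2) : letter (i, true) = FreeGroup.of i := rfl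

theorem letter_false (i : Fin 2) : letter (i, false) = (FreeGroup.of i)⁻¹ := by
  rw [← letter_true, letter_inv]; rfl

theorem letter_injective : Function.Injective letter := by
  intro a b h
  have := congrArg FreeGroup.toWord h
  simpa [letter, FreeGroup.toWord_mk, FreeGroup.reduce_singleton] using this

section Nielsen

/-- Nielsen's conditions on the images of the letters under a homomorphism. -/
structure NielsenReduced (f : Fin 2 × Bool → F2) : Prop where
  ne_one : ∀ a, f a ≠ 1
  le_left : ∀ a b, (a.1 = b.1 → a.2 = b.2) →
    2 * FreeGroup.gromov (f a)⁻¹ (f b) ≤ (f a).norm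
  le_right : ∀ a b, (a.1 = b.1 → a.2 = b.2) →
    2 * FreeGroup.gromov (f a)⁻¹ (f b) ≤ (f b).norm
  lt_mid : ∀ a b c, (a.1 = b.1 → a.2 = b.2) → (b.1 = c.1 → b.2 = c.2) →
    FreeGroup.gromov (f a)⁻¹ (f b) + FreeGroup.gromov (f b)⁻¹ (f c) < (f b).norm

namespace NielsenReduced

variable {f : Fin 2 × Bool → F2}

theorem lt_gromov_and_gromov_eq (hf : NielsenReduced f) (L : List (Fin 2 × Bool))
    (a b : Fin 2 × Bool) (hL : FreeGroup.IsReduced (a :: b :: L)) :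
    FreeGroup.gromov (f a)⁻¹ (f b) < FreeGroup.gromov (f b) ((b :: L).map f).prod ∧
      FreeGroup.gromov (f a)⁻¹ ((b :: L).map f).prod = FreeGroup.gromov (f a)⁻¹ (f b) := by
  induction L generalizing a b with
  | nil =>
    have h1 := hf.le_right a b (FreeGroup.isReduced_cons_cons.1 hL).1
    have h2 : (f b).norm ≠ 0 := by simpa [FreeGroup.norm_eq_zero] using hf.ne_one b
    have h3 := FreeGroup.norm_inv_mul_add (f b) (f b)
    simp only [inv_mul_cancel, FreeGroup.norm_one] at h3
    simp only [List.map_cons, List.map_nil, List.prod_cons, List.prod_nil, mul_one, and_true]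
    omega
  | cons c L ih =>
    have hab := FreeGroup.isReduced_cons_cons.1 hL
    have hbc := FreeGroup.isReduced_cons_cons.1 hab.2
    have h1 := (ih b c hab.2).2
    have h2 := hf.lt_mid a b c hab.1 hbc.1
    rw [List.map_cons, List.prod_cons]
    set h := (List.map f (c :: L)).prod
    have h3 := FreeGroup.gromov_mul_left (f b) h
    have h4 := FreeGroup.min_gromov_le (f a)⁻¹ (f b) (f b * h)
    have h5 := FreeGroup.min_gromov_le (f a)⁻¹ (f b * h) (f b)
    rw [FreeGroup.gromov_comm (f b) (f b * h)] at *
    omega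

theorem two_le_norm_prod (hf : NielsenReduced f) (L : List (Fin 2 × Bool))
    (a b : Fin 2 × Bool) (hL : FreeGroup.IsReduced (a :: b :: L)) :
    2 ≤ ((a :: b :: L).map f).prod.norm := by
  obtain ⟨h1, h2⟩ := hf.lt_gromov_and_gromov_eq L a b hL
  rw [List.map_cons, List.prod_cons]
  set h := (List.map f (b :: L)).prod
  have h3 := FreeGroup.norm_mul_add (f a) h
  have h4 := hf.le_left a b (FreeGroup.isReduced_cons_cons.1 hL).1
  have h5 : (f a).norm ≠ 0 := by simpa [FreeGroup.norm_eq_zero] using hf.ne_one a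
  have h6 := FreeGroup.gromov_le_right (f b) h
  omega

end NielsenReduced

theorem prod_map_letter (γ : F2 ≃* F2) (L : List (Fin 2 × Bool)) :
    (L.map fun a => γ (letter a)).prod = γ (FreeGroup.mk L) := by
  induction L with
  | nil => simp [← FreeGroup.one_eq_mk]
  | cons a L ih =>
    rw [List.map_cons, List.prod_cons, ih, ← map_mul, letter, FreeGroup.mul_mk]
    rfl

theorem NielsenReduced.norm_symm_letter {γ : F2 ≃* F2}
    (hγ : NielsenReduced fun a => γ (letter a)) (a : Fin 2 × Bool) :
    (γ.symm (letter a)).norm = 1 := by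
  set w := γ.symm (letter a) with hw
  have hprod : (w.toWord.map fun a => γ (letter a)).prod.norm = 1 := by
    rw [prod_map_letter, FreeGroup.mk_toWord, hw, MulEquiv.apply_symm_apply, norm_letter]
  have hred := FreeGroup.isReduced_toWord (x := w)
  rw [FreeGroup.norm]
  rcases h : w.toWord with _ | ⟨b, _ | ⟨c, L⟩⟩
  · simp [h] at hprod
  · rfl
  · rw [h] at hprod hred
    have := hγ.two_le_norm_prod L b c hred
    omega

end Nielsen

section Automorphisms

theorem MonoidHom.ext_F2 {G : Type*} [Monoid G] {f g : F2 →* G} (hx : f xg = g xg)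
    (hy : f yg = g yg) : f = g :=
  FreeGroup.ext_hom _ _ fun i => by fin_cases i <;> assumption

theorem MulAut.ext_F2 {f g : MulAut F2} (hx : f xg = g xg) (hy : f yg = g yg) : f = g :=
  MulEquiv.toMonoidHom_injective (MonoidHom.ext_F2 hx hy)

/-- The endomorphism of `F₂` with `x ↦ u` and `y ↦ v`. -/
def genHom (u v : F2) : F2 →* F2 := FreeGroup.lift ![u, v]

@[simp] theorem genHom_xg (u v : F2) : genHom u v xg = u := by simp [genHom, xg]

@[simp] theorem genHom_yg (u v : F2) : genHom u v yg = v := by simp [genHom, yg]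

/-- The automorphism `x ↦ y`, `y ↦ x`. -/
def swapAut : MulAut F2 :=
  MonoidHom.toMulEquiv (genHom yg xg) (genHom yg xg)
    (MonoidHom.ext_F2 (by simp) (by simp)) (MonoidHom.ext_F2 (by simp) (by simp))

/-- The automorphism `x ↦ x⁻¹`, `y ↦ y`. -/
def invAut : MulAut F2 :=
  MonoidHom.toMulEquiv (genHom xg⁻¹ yg) (genHom xg⁻¹ yg)
    (MonoidHom.ext_F2 (by simp) (by simp)) (MonoidHom.ext_F2 (by simp) (by simp))

/-- The automorphism `x ↦ x`, `y ↦ x ^ k * y`. -/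
def twistX (k : ℤ) : MulAut F2 :=
  MonoidHom.toMulEquiv (genHom xg (xg ^ k * yg)) (genHom xg (xg ^ (-k) * yg))
    (MonoidHom.ext_F2 (by simp) (by simp)) (MonoidHom.ext_F2 (by simp) (by simp))

/-- The automorphism `x ↦ y ^ k * x`, `y ↦ y`. -/
def twistY (k : ℤ) : MulAut F2 :=
  MonoidHom.toMulEquiv (genHom (yg ^ k * xg) yg) (genHom (yg ^ (-k) * xg) yg)
    (MonoidHom.ext_F2 (by simp) (by simp)) (MonoidHom.ext_F2 (by simp) (by simp))

@[simp] theorem swapAut_xg : swapAut xg = yg := genHom_xg yg xg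
@[simp] theorem swapAut_yg : swapAut yg = xg := genHom_yg yg xg
@[simp] theorem invAut_xg : invAut xg = xg⁻¹ := genHom_xg xg⁻¹ yg
@[simp] theorem invAut_yg : invAut yg = yg := genHom_yg xg⁻¹ yg
@[simp] theorem twistX_xg (k : ℤ) : twistX k xg = xg :=
  genHom_xg xg (xg ^ k * yg)
@[simp] theorem twistX_yg (k : ℤ) : twistX k yg = xg ^ k * yg :=
  genHom_yg xg (xg ^ k * yg)
@[simp] theorem twistY_xg (k : ℤ) : twistY k xg = yg ^ k * xg :=
  genHom_xg (yg ^ k * xg) yg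
@[simp] theorem twistY_yg (k : ℤ) : twistY k yg = yg := genHom_yg (yg ^ k * xg) yg

theorem swapAut_mul_self : swapAut * swapAut = 1 := MulAut.ext_F2 (by simp) (by simp)

theorem invAut_mul_self : invAut * invAut = 1 := MulAut.ext_F2 (by simp) (by simp)

theorem swapAut_mul_twistX_mul (k : ℤ) : swapAut * twistX k * swapAut = twistY k :=
  MulAut.ext_F2 (by simp) (by simp)

/-- The group of signed permutations of the generators. -/
def signedPerms : Subgroup (MulAut F2) := Subgroup.closure {swapAut, invAut}

theorem swapAut_mem : swapAut ∈ signedPerms := Subgroup.subset_closure (by simp)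

theorem invAut_mem : invAut ∈ signedPerms := Subgroup.subset_closure (by simp)

theorem exists_signedPerm {a b : Fin 2 × Bool} (h : a.1 ≠ b.1) :
    ∃ σ ∈ signedPerms, σ xg = letter a ∧ σ yg = letter b := by
  have s := swapAut_mem
  have e := invAut_mem
  have t := mul_mem (mul_mem s e) s
  obtain ⟨i, c⟩ := a
  obtain ⟨j, d⟩ := b
  have hx : letter (0, true) = xg := rfl
  have hy : letter (1, true) = yg := rfl
  have hx' : letter (0, false) = xg⁻¹ := letter_false 0
  have hy' : letter (1, false) = yg⁻¹ := letter_false 1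
  fin_cases i <;> fin_cases j <;> cases c <;> cases d <;> simp at h <;>
    simp only [Fin.zero_eta, Fin.mk_one, hx, hy, hx', hy']
  · exact ⟨_, mul_mem e t, by simp, by simp⟩
  · exact ⟨_, e, by simp, by simp⟩
  · exact ⟨_, t, by simp, by simp⟩
  · exact ⟨_, one_mem _, by simp, by simp⟩
  · exact ⟨_, mul_mem s (mul_mem e t), by simp, by simp⟩
  · exact ⟨_, mul_mem s e, by simp, by simp⟩
  · exact ⟨_, mul_mem s t, by simp, by simp⟩
  · exact ⟨_, s, by simp, by simp⟩

theorem exists_eq_letter_of_mem_signedPerms {σ : MulAut F2} (hσ : σ ∈ signedPerms)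
    (a : Fin 2 × Bool) : ∃ b, σ (letter a) = letter b := by
  have key : ∀ τ ∈ ({swapAut, invAut} : Set (MulAut F2)), ∀ a : Fin 2 × Bool,
      ∃ b, τ (letter a) = letter b := by
    have base : ∀ τ : MulAut F2, (∀ i : Fin 2, ∃ b, τ (FreeGroup.of i) = letter b) →
        ∀ a : Fin 2 × Bool, ∃ b, τ (letter a) = letter b := by
      rintro τ hτ ⟨i, c⟩
      obtain ⟨b, hb⟩ := hτ i
      cases c
      · exact ⟨(b.1, !b.2), by rw [letter_false, map_inv, hb, letter_inv]⟩
      · exact ⟨b, hb⟩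
    rintro τ (rfl | rfl) <;> refine base _ fun i => ?_ <;> fin_cases i
    · exact ⟨_, swapAut_xg⟩
    · exact ⟨_, swapAut_yg⟩
    · exact ⟨_, invAut_xg.trans (letter_false 0).symm⟩
    · exact ⟨_, invAut_yg⟩
  have hinv : ∀ τ ∈ ({swapAut, invAut} : Set (MulAut F2)), τ⁻¹ = τ := by
    rintro τ (rfl | rfl)
    · exact inv_eq_of_mul_eq_one_left swapAut_mul_self
    · exact inv_eq_of_mul_eq_one_left invAut_mul_self
  induction hσ using Subgroup.closure_induction_left generalizing a with
  | one => exact ⟨a, rfl⟩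
  | mul_left τ hτ σ _ ih =>
    obtain ⟨b, hb⟩ := ih a
    rw [MulAut.mul_apply, hb]
    exact key τ hτ b
  | inv_mul_cancel τ hτ σ _ ih =>
    obtain ⟨b, hb⟩ := ih a
    rw [hinv τ hτ, MulAut.mul_apply, hb]
    exact key τ hτ b

theorem mem_signedPerms_of_norm {σ : MulAut F2} (hσ : ∀ a, (σ (letter a)).norm = 1) :
    σ ∈ signedPerms := by
  obtain ⟨a, ha⟩ := exists_eq_letter (hσ (0, true))
  obtain ⟨b, hb⟩ := exists_eq_letter (hσ (1, true))
  have hab : a.1 ≠ b.1 := by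
    intro h
    have h' : a = b ∨ b = (a.1, !a.2) := by
      obtain ⟨i, c⟩ := a
      obtain ⟨j, d⟩ := b
      simp only at h
      subst h
      cases c <;> cases d <;> simp
    rcases h' with rfl | rfl
    · have := letter_injective (σ.injective (ha.trans hb.symm))
      simp at this
    · rw [← letter_inv, ← ha, ← map_inv, letter_inv] at hb
      have := letter_injective (σ.injective hb)
      simp at this
  obtain ⟨τ, hτ, hτx, hτy⟩ := exists_signedPerm hab
  have : σ = τ := MulAut.ext_F2 (by rw [hτx, ← ha]; rfl) (by rw [hτy, ← hb]; rfl)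
  rwa [this]

/-- The group generated by the inner automorphisms, the signed permutations of the generators and
the elementary Nielsen move. -/
def nielsenGroup : Subgroup (MulAut F2) :=
  Subgroup.closure (Set.range MulAut.conj ∪ {swapAut, invAut, twistX 1})

theorem conj_mem_nielsenGroup (g : F2) : MulAut.conj g ∈ nielsenGroup :=
  Subgroup.subset_closure (Or.inl ⟨g, rfl⟩)

theorem twistX_mem_nielsenGroup : twistX 1 ∈ nielsenGroup :=
  Subgroup.subset_closure (Or.inr (by simp))

theorem signedPerms_le_nielsenGroup : signedPerms ≤ nielsenGroup :=
  Subgroup.closure_mono fun τ hτ => Or.inr (by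
    rcases hτ with rfl | rfl <;> simp)

theorem twistY_mem_nielsenGroup : twistY 1 ∈ nielsenGroup := by
  rw [← swapAut_mul_twistX_mul]
  exact mul_mem (mul_mem (signedPerms_le_nielsenGroup swapAut_mem) twistX_mem_nielsenGroup)
    (signedPerms_le_nielsenGroup swapAut_mem)

/-- The size of an automorphism, to be decreased by Nielsen moves. -/
def autSize (γ : MulAut F2) : ℕ := (γ xg).norm + (γ yg).norm

theorem autSize_mul_signedPerm (γ : MulAut F2) {σ : MulAut F2} {a b : Fin 2 × Bool}
    (h : a.1 ≠ b.1) (hx : σ xg = letter a) (hy : σ yg = letter b) :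
    autSize (γ * σ) = autSize γ := by
  obtain ⟨i, c⟩ := a
  obtain ⟨j, d⟩ := b
  have hn : ∀ i c, (γ (letter (i, c))).norm = (γ (FreeGroup.of i)).norm := by
    intro i c
    cases c
    · rw [letter_false, map_inv, FreeGroup.norm_inv_eq]
    · rfl
  rw [autSize, MulAut.mul_apply, MulAut.mul_apply, hx, hy, hn, hn, autSize]
  fin_cases i <;> fin_cases j <;> simp at h
  · rfl
  · exact add_comm _ _

theorem nielsenReduced_of_autSize_minimal {γ : MulAut F2}
    (hmin : ∀ ε ∈ nielsenGroup, ∀ g, autSize γ ≤ autSize (MulAut.conj g * (γ * ε))) :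
    NielsenReduced fun a => γ (letter a) := by
  have hinv : ∀ a : Fin 2 × Bool, γ (letter (a.1, !a.2)) = (γ (letter a))⁻¹ := by
    intro a
    rw [← letter_inv, map_inv]
  have hmoves : ∀ a b : Fin 2 × Bool, a.1 ≠ b.1 →
      (γ (letter a)).norm ≤ (γ (letter a) * γ (letter b)).norm ∧
      (γ (letter b)).norm ≤ (γ (letter a) * γ (letter b)).norm ∧
      ∀ g : F2, (γ (letter a)).norm + (γ (letter b)).norm ≤
        (g⁻¹ * (γ (letter a) * γ (letter b)) * g).norm + (g⁻¹ * γ (letter b) * g).norm := by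
    intro a b hab
    obtain ⟨σ, hσ, hx, hy⟩ := exists_signedPerm hab
    have hs : autSize γ = (γ (letter a)).norm + (γ (letter b)).norm := by
      rw [← autSize_mul_signedPerm γ hab hx hy, autSize, MulAut.mul_apply, MulAut.mul_apply, hx, hy]
    have hσ' := signedPerms_le_nielsenGroup hσ
    have hN := mul_mem (conj_mem_nielsenGroup yg⁻¹) twistY_mem_nielsenGroup
    have hNx : (MulAut.conj yg⁻¹ * twistY 1) xg = xg * yg := by simp [-map_inv]
    have hNy : (MulAut.conj yg⁻¹ * twistY 1) yg = yg := by simp [-map_inv]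
    generalize MulAut.conj yg⁻¹ * twistY 1 = N at hN hNx hNy
    have h1 := hmin _ (mul_mem hσ' hN)
    have h2 := hmin _ (mul_mem hσ' twistX_mem_nielsenGroup) 1
    rw [hs] at h1 h2
    simp only [autSize, MulAut.mul_apply, twistX_xg, twistX_yg, hNx, hNy, map_mul, hx, hy,
      MulAut.conj_apply, zpow_one, inv_one, one_mul, mul_one] at h1 h2
    have h3 := h1 1
    simp only [one_mul, inv_one, mul_one] at h3
    refine ⟨by omega, by omega, fun g => ?_⟩
    simpa [mul_assoc] using h1 g⁻¹
  have hne : ∀ a, γ (letter a) ≠ 1 := by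
    intro a h
    have h1 : letter a = 1 := (map_eq_one_iff γ γ.injective).1 h
    have h2 := norm_letter a
    rw [h1] at h2
    simp at h2
  have hself : ∀ a, 2 * FreeGroup.gromov (γ (letter a))⁻¹ (γ (letter a)) < (γ (letter a)).norm := by
    intro a
    rw [FreeGroup.gromov_comm]
    exact FreeGroup.two_mul_gromov_inv_lt (hne a)
  have hle : ∀ a b : Fin 2 × Bool, (a.1 = b.1 → a.2 = b.2) →
      2 * FreeGroup.gromov (γ (letter a))⁻¹ (γ (letter b)) ≤ (γ (letter a)).norm ∧
      2 * FreeGroup.gromov (γ (letter a))⁻¹ (γ (letter b)) ≤ (γ (letter b)).norm := by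
    intro a b hab
    by_cases h : a.1 = b.1
    · obtain rfl : a = b := Prod.ext h (hab h)
      exact ⟨(hself a).le, (hself a).le⟩
    · have h1 := hmoves a b h
      have h2 := FreeGroup.norm_mul_add (γ (letter a)) (γ (letter b))
      omega
  refine ⟨hne, fun a b h => (hle a b h).1, fun a b h => (hle a b h).2, ?_⟩
  intro a b c hab hbc
  have t1 := (hle a b hab).2
  have t2 := (hle b c hbc).1
  by_contra! hcon
  by_cases h1 : a.1 = b.1
  · obtain rfl : a = b := Prod.ext h1 (hab h1)
    have := hself a
    omega
  by_cases h2 : b.1 = c.1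
  · obtain rfl : b = c := Prod.ext h2 (hbc h2)
    have := hself b
    omega
  have h3 : c = (a.1, !a.2) ∨ c = a := by
    obtain ⟨i, p⟩ := a
    obtain ⟨j, q⟩ := b
    obtain ⟨k, r⟩ := c
    simp only at h1 h2
    have : k = i := by omega
    subst this
    cases p <;> cases r <;> simp
  have hb := hself b
  rw [FreeGroup.gromov_comm] at hb
  rcases h3 with rfl | rfl
  · simp only [hinv] at hcon t2
    have m := FreeGroup.min_gromov_le (γ (letter b)) (γ (letter a))⁻¹ (γ (letter b))⁻¹
    rw [FreeGroup.gromov_comm (γ (letter b)) (γ (letter a))⁻¹,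
      FreeGroup.gromov_comm (γ (letter a))⁻¹ (γ (letter b))⁻¹] at m
    omega
  · have hw := (hle c b hab).1
    have hmin' := (hmoves c b h1).2.2
    have hg0 : (γ (letter b)).norm ≠ 0 := by simpa [FreeGroup.norm_eq_zero] using hne b
    generalize γ (letter c) = w at *
    generalize γ (letter b) = g at *
    have hginv : g⁻¹.norm = g.norm := FreeGroup.norm_inv_eq
    obtain ⟨q, hq1, hq2⟩ := FreeGroup.exists_norm_eq_gromov_eq g⁻¹ (FreeGroup.gromov g⁻¹ w)
      (FreeGroup.gromov_le_left _ _)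
    have hgq : FreeGroup.gromov g⁻¹ q = q.norm := by omega
    have hwq : FreeGroup.gromov w q = q.norm := FreeGroup.gromov_eq_of_le hgq (by omega)
    have e1 := FreeGroup.gromov_mul_left w g
    have e2 := FreeGroup.gromov_mul_left g⁻¹ w⁻¹
    have e3 := FreeGroup.norm_mul_add w g
    rw [inv_inv, FreeGroup.gromov_comm g w⁻¹] at e2
    have hwgq : FreeGroup.gromov (w * g) q = q.norm :=
      FreeGroup.gromov_eq_of_le hwq (by rw [FreeGroup.gromov_comm]; omega)
    have hwgq' : FreeGroup.gromov (w * g)⁻¹ q = q.norm := by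
      rw [mul_inv_rev]
      exact FreeGroup.gromov_eq_of_le hgq (by rw [FreeGroup.gromov_comm]; omega)
    have e4 := FreeGroup.norm_conj_of_gromov_eq hwgq hwgq' (by omega)
    have e5 := FreeGroup.norm_inv_mul_add g⁻¹ q
    rw [inv_inv] at e5
    have e6 := FreeGroup.norm_mul_le q⁻¹ (g * q)
    rw [← mul_assoc, FreeGroup.norm_inv_eq] at e6
    have := hmin' q
    omega

theorem mem_nielsenGroup (γ : MulAut F2) : γ ∈ nielsenGroup := by
  induction h : autSize γ using Nat.strong_induction_on generalizing γ with
  | _ n ih =>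
    by_cases hmin : ∀ ε ∈ nielsenGroup, ∀ g, autSize γ ≤ autSize (MulAut.conj g * (γ * ε))
    · have h1 : γ⁻¹ ∈ signedPerms :=
        mem_signedPerms_of_norm (nielsenReduced_of_autSize_minimal hmin).norm_symm_letter
      exact inv_mem_iff.1 (signedPerms_le_nielsenGroup h1)
    · push Not at hmin
      obtain ⟨ε, hε, g, hlt⟩ := hmin
      have h1 := ih _ (h ▸ hlt) _ rfl
      rwa [Subgroup.mul_mem_cancel_left _ (conj_mem_nielsenGroup g),
        Subgroup.mul_mem_cancel_right _ hε] at h1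

end Automorphisms

section AutMat

theorem expSum_of (i j : Fin 2) :
    Multiplicative.toAdd (expSum i (FreeGroup.of j)) = if j = i then 1 else 0 := by
  simp [expSum]

theorem expSum_apply_aut (γ : MulAut F2) (i : Fin 2) (w : F2) :
    Multiplicative.toAdd (expSum i (γ w)) =
      autMat γ i 0 * Multiplicative.toAdd (expSum 0 w) +
        autMat γ i 1 * Multiplicative.toAdd (expSum 1 w) := by
  induction w using FreeGroup.induction_on with
  | C1 => simp
  | of j => fin_cases j <;> simp [expSum_of, autMat]
  | inv_of j h => rw [map_inv, map_inv, toAdd_inv, h]; simp; ring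
  | mul u v hu hv => rw [map_mul, map_mul, toAdd_mul, hu, hv]; simp; ring

/-- The map `β̂` as a monoid homomorphism. -/
def autMatHom : MulAut F2 →* Matrix (Fin 2) (Fin 2) ℤ where
  toFun := autMat
  map_one' := by
    ext i j
    simp [autMat, expSum_of, Matrix.one_apply, eq_comm]
  map_mul' γ δ := by
    ext i j
    rw [Matrix.mul_apply, Fin.sum_univ_two]
    exact expSum_apply_aut γ i _

theorem autMat_one : autMat (1 : MulAut F2) = 1 := map_one autMatHom

theorem autMat_mul (γ δ : MulAut F2) : autMat (γ * δ) = autMat γ * autMat δ :=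
  map_mul autMatHom γ δ

theorem autMat_conj (g : F2) : autMat (MulAut.conj g) = 1 := by
  ext i j
  simp [autMat, expSum_of, Matrix.one_apply, eq_comm]

theorem autMat_twistX (k : ℤ) : autMat (twistX k) = !![1, k; 0, 1] := by
  have hx := twistX_xg k
  have hy := twistX_yg k
  simp only [xg, yg] at hx hy
  ext i j
  fin_cases i <;> fin_cases j <;> simp [autMat, hx, hy, expSum_of]

theorem autMat_twistY (k : ℤ) : autMat (twistY k) = !![1, 0; k, 1] := by
  have hx := twistY_xg k
  have hy := twistY_yg k
  simp only [xg, yg] at hx hy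
  ext i j
  fin_cases i <;> fin_cases j <;> simp [autMat, hx, hy, expSum_of]

theorem autMat_signedPerm_col_sum_le {σ : MulAut F2} (hσ : σ ∈ signedPerms) (j : Fin 2) :
    autMat σ 0 j + autMat σ 1 j ≤ 1 := by
  obtain ⟨⟨i, c⟩, hb⟩ := exists_eq_letter_of_mem_signedPerms hσ (j, true)
  rw [letter_true] at hb
  simp only [autMat, Matrix.of_apply, hb]
  cases c <;> fin_cases i <;> simp [letter_true, letter_false, expSum_of]

theorem eq_one_of_mem_signedPerms {σ : MulAut F2} (hσ : σ ∈ signedPerms) (h : autMat σ = 1) :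
    σ = 1 := by
  have key : ∀ j, σ (FreeGroup.of j) = FreeGroup.of j := by
    intro j
    obtain ⟨⟨i, c⟩, hb⟩ := exists_eq_letter_of_mem_signedPerms hσ (j, true)
    rw [letter_true] at hb
    have h1 : autMat σ j j = 1 := by rw [h, Matrix.one_apply_eq]
    simp only [autMat, Matrix.of_apply, hb] at h1
    cases c
    · rw [letter_false, map_inv, toAdd_inv, expSum_of] at h1
      split_ifs at h1; omega
    · rw [letter_true, expSum_of] at h1
      rw [hb, letter_true, show i = j by by_contra hij; simp [hij] at h1]
  exact MulAut.ext_F2 (key 0) (key 1)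

end AutMat

section Positive

/-- The monoid of positive words in the two elementary twists. -/
def positiveTwists : Submonoid (MulAut F2) := Submonoid.closure {twistX 1, twistY 1}

theorem autMat_positiveTwists {p : MulAut F2} (hp : p ∈ positiveTwists) :
    (∀ i j, 0 ≤ autMat p i j) ∧ (∀ i, 1 ≤ autMat p i 0 + autMat p i 1) ∧
      (p = 1 ∨ 3 ≤ autMat p 0 0 + autMat p 0 1 + (autMat p 1 0 + autMat p 1 1)) := by
  induction hp using Submonoid.closure_induction_left with
  | one =>
    rw [autMat_one]
    refine ⟨fun i j => ?_, fun i => ?_, Or.inl rfl⟩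
    · fin_cases i <;> fin_cases j <;> simp
    · revert i; decide
  | mul_left τ hτ p _ ih =>
    obtain ⟨h1, h2, -⟩ := ih
    have := h1 0 0
    have := h1 0 1
    have := h1 1 0
    have := h1 1 1
    have := h2 0
    have := h2 1
    rcases hτ with rfl | rfl
    · rw [autMat_mul, autMat_twistX, Matrix.eta_fin_two (autMat p)]
      simp only [Fin.forall_fin_two, Matrix.mul_apply, Fin.sum_univ_two]
      simp
      omega
    · rw [autMat_mul, autMat_twistY, Matrix.eta_fin_two (autMat p)]
      simp only [Fin.forall_fin_two, Matrix.mul_apply, Fin.sum_univ_two]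
      simp
      omega

/-- In a group generated by `s, e, t` subject to the relations of the images of the swap, the
inversion and the elementary twist in `GL₂(ℤ)`, every element is, up to elements of `⟨s, e⟩` on both
sides, a positive word in `t` and `s * t * s`. -/
theorem exists_positive_of_mem_closure {G : Type*} [Group G] {s e t l : G} (hs : s * s = 1)
    (he : e * e = 1) (hl : s * t * s = l) (het : e * t * e = t⁻¹) (hel : e * l * e = l⁻¹)
    (hlt : l * t⁻¹ = t * (e * s)) {g : G} (hg : g ∈ Subgroup.closure {s, e, t}) :
    ∃ d ∈ Subgroup.closure {s, e}, ∃ p ∈ Submonoid.closure {t, l},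
      ∃ σ ∈ Subgroup.closure {s, e}, g = d * p * σ := by
  have hsK : s ∈ Subgroup.closure {s, e} := Subgroup.subset_closure (by simp)
  have heK : e ∈ Subgroup.closure {s, e} := Subgroup.subset_closure (by simp)
  have htP : t ∈ Submonoid.closure {t, l} := Submonoid.subset_closure (by simp)
  have hlP : l ∈ Submonoid.closure {t, l} := Submonoid.subset_closure (by simp)
  have hs' : s⁻¹ = s := inv_eq_of_mul_eq_one_left hs
  have he' : e⁻¹ = e := inv_eq_of_mul_eq_one_left he
  have htl : t * l⁻¹ = l * (s * e) := by
    calc t * l⁻¹ = s * (l * t⁻¹) * s := by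
          rw [← hl]; simp only [mul_inv_rev, hs', mul_assoc]
          simp only [← mul_assoc, hs, one_mul]
      _ = (s * t * s) * (s * e) * (s * s) := by
          rw [hlt]; simp only [mul_assoc, hs, mul_one]; rw [← mul_assoc s s, hs, one_mul]
      _ = l * (s * e) := by rw [hl, hs, mul_one]
  have hinv : ∀ p ∈ Submonoid.closure {t, l}, ∀ z ∈ ({t, l} : Set G),
      ∃ d ∈ Subgroup.closure {s, e}, ∃ q ∈ Submonoid.closure {t, l},
        ∃ σ ∈ Subgroup.closure {s, e}, p * z⁻¹ = d * q * σ := by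
    intro p hp z hz
    induction hp using Submonoid.closure_induction_right with
    | one =>
      refine ⟨e, heK, z, Submonoid.subset_closure hz, e, heK, ?_⟩
      rcases hz with rfl | rfl
      · rw [het, one_mul]
      · rw [hel, one_mul]
    | mul_right p hp w hw _ =>
      rcases hz with rfl | rfl <;> rcases hw with rfl | rfl
      · exact ⟨1, one_mem _, p, hp, 1, one_mem _, by simp⟩
      · exact ⟨1, one_mem _, p * z, mul_mem hp htP, e * s, mul_mem heK hsK, by
          rw [mul_assoc, hlt]; simp [mul_assoc]⟩
      · exact ⟨1, one_mem _, p * z, mul_mem hp hlP, s * e, mul_mem hsK heK, by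
          rw [mul_assoc, htl]; simp [mul_assoc]⟩
      · exact ⟨1, one_mem _, p, hp, 1, one_mem _, by simp⟩
  have hconj : ∀ σ ∈ Subgroup.closure {s, e}, ∀ z ∈ ({t, l, t⁻¹, l⁻¹} : Set G),
      σ * z * σ⁻¹ ∈ ({t, l, t⁻¹, l⁻¹} : Set G) := by
    have hsl : s * l * s = t := by
      rw [← hl]; simp only [mul_assoc, hs, mul_one]; rw [← mul_assoc, hs, one_mul]
    have hst' : s * t⁻¹ * s = l⁻¹ := by rw [← hl]; simp [hs', mul_assoc]
    have hsl' : s * l⁻¹ * s = t⁻¹ := by rw [← hsl]; simp [hs', mul_assoc]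
    have het' : e * t⁻¹ * e = t := by
      rw [← het]; simp only [mul_assoc, he, mul_one]; rw [← mul_assoc, he, one_mul]
    have hel' : e * l⁻¹ * e = l := by
      rw [← hel]; simp only [mul_assoc, he, mul_one]; rw [← mul_assoc, he, one_mul]
    have base : ∀ τ ∈ ({s, e} : Set G), ∀ z ∈ ({t, l, t⁻¹, l⁻¹} : Set G),
        τ * z * τ ∈ ({t, l, t⁻¹, l⁻¹} : Set G) := by
      rintro τ (rfl | rfl) z (rfl | rfl | rfl | rfl) <;> simp [*]
    intro σ hσ
    induction hσ using Subgroup.closure_induction_left with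
    | one => intro z hz; simpa using hz
    | mul_left τ hτ σ _ ih =>
      intro z hz
      have hτ' : τ⁻¹ = τ := by rcases hτ with rfl | rfl <;> assumption
      have := base τ hτ _ (ih z hz)
      rwa [mul_inv_rev, hτ', ← mul_assoc, mul_assoc τ, mul_assoc τ]
    | inv_mul_cancel τ hτ σ _ ih =>
      intro z hz
      have hτ' : τ⁻¹ = τ := by rcases hτ with rfl | rfl <;> assumption
      have := base τ hτ _ (ih z hz)
      rwa [mul_inv_rev, hτ', hτ', ← mul_assoc, mul_assoc τ, mul_assoc τ]
  have hstep : ∀ d ∈ Subgroup.closure {s, e}, ∀ p ∈ Submonoid.closure {t, l},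
      ∀ σ ∈ Subgroup.closure {s, e}, ∀ z ∈ ({t, l, t⁻¹, l⁻¹} : Set G),
      ∃ d' ∈ Subgroup.closure {s, e}, ∃ q ∈ Submonoid.closure {t, l},
        ∃ σ' ∈ Subgroup.closure {s, e}, d * p * σ * z = d' * q * σ' := by
    intro d hd p hp σ hσ z hz
    have h1 := hconj σ hσ z hz
    have h2 : d * p * σ * z = d * (p * (σ * z * σ⁻¹)) * σ := by group
    rw [h2]
    generalize σ * z * σ⁻¹ = w at *
    have h3 : ∃ d' ∈ Subgroup.closure {s, e}, ∃ q ∈ Submonoid.closure {t, l},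
        ∃ σ' ∈ Subgroup.closure {s, e}, p * w = d' * q * σ' := by
      rcases h1 with rfl | rfl | rfl | rfl
      · exact ⟨1, one_mem _, _, mul_mem hp htP, 1, one_mem _, by simp⟩
      · exact ⟨1, one_mem _, _, mul_mem hp hlP, 1, one_mem _, by simp⟩
      · exact hinv p hp _ (by simp)
      · exact hinv p hp _ (by simp)
    obtain ⟨d', hd', q, hq, σ', hσ', h⟩ := h3
    exact ⟨d * d', mul_mem hd hd', q, hq, σ' * σ, mul_mem hσ' hσ, by
      rw [h]; simp only [mul_assoc]⟩
  induction hg using Subgroup.closure_induction_right with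
  | one => exact ⟨1, one_mem _, 1, one_mem _, 1, one_mem _, by simp⟩
  | mul_right g _ z hz ih =>
    obtain ⟨d, hd, p, hp, σ, hσ, rfl⟩ := ih
    rcases hz with rfl | rfl | rfl
    · exact ⟨d, hd, p, hp, _, mul_mem hσ hsK, by simp only [mul_assoc]⟩
    · exact ⟨d, hd, p, hp, _, mul_mem hσ heK, by simp only [mul_assoc]⟩
    · exact hstep d hd p hp σ hσ _ (by simp)
  | mul_inv_cancel g _ z hz ih =>
    obtain ⟨d, hd, p, hp, σ, hσ, rfl⟩ := ih
    rcases hz with rfl | rfl | rfl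
    · exact ⟨d, hd, p, hp, _, mul_mem hσ (inv_mem hsK), by simp only [mul_assoc]⟩
    · exact ⟨d, hd, p, hp, _, mul_mem hσ (inv_mem heK), by simp only [mul_assoc]⟩
    · exact hstep d hd p hp σ hσ _ (by simp)

/-- The inner automorphisms of `F₂`. -/
def innerAuts : Subgroup (MulAut F2) := (MulAut.conj : F2 →* MulAut F2).range

instance innerAuts_normal : innerAuts.Normal where
  conj_mem := by
    rintro _ ⟨g, rfl⟩ γ
    exact ⟨γ g, by ext w; simp⟩

theorem exists_conj_mul_positive (γ : MulAut F2) :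
    ∃ g : F2, ∃ d ∈ signedPerms, ∃ p ∈ positiveTwists, ∃ σ ∈ signedPerms,
      γ = d * p * σ * MulAut.conj g := by
  let π := QuotientGroup.mk' innerAuts
  have hconj : ∀ g, π (MulAut.conj g) = 1 := fun g => (QuotientGroup.eq_one_iff _).2 ⟨g, rfl⟩
  have hγ : π γ ∈ Subgroup.closure {π swapAut, π invAut, π (twistX 1)} := by
    have h1 := Subgroup.mem_map_of_mem π (mem_nielsenGroup γ)
    rw [nielsenGroup, MonoidHom.map_closure] at h1
    refine (Subgroup.closure_le _).2 ?_ h1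
    rintro _ ⟨δ, ⟨g, rfl⟩ | hδ, rfl⟩
    · rw [hconj]; exact one_mem _
    · refine Subgroup.subset_closure ?_
      rcases hδ with rfl | rfl | rfl <;> simp
  have hK : Subgroup.closure {π swapAut, π invAut} = signedPerms.map π := by
    rw [signedPerms, MonoidHom.map_closure, Set.image_pair]
  have hP : Submonoid.closure {π (twistX 1), π (twistY 1)} = positiveTwists.map π := by
    rw [positiveTwists, MonoidHom.map_mclosure, Set.image_pair]
  have h1 := exists_positive_of_mem_closure (l := π (twistY 1))
    (by rw [← map_mul, swapAut_mul_self, map_one])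
    (by rw [← map_mul, invAut_mul_self, map_one])
    (by rw [← map_mul, ← map_mul, swapAut_mul_twistX_mul])
    (by
      rw [← map_mul, ← map_mul, ← map_inv]
      refine congrArg π (eq_inv_of_mul_eq_one_left (MulAut.ext_F2 ?_ ?_)) <;> simp)
    (by
      rw [← map_mul, ← map_mul, ← map_inv, ← one_mul (π (twistY 1)⁻¹), ← hconj yg, ← map_mul]
      refine congrArg π (eq_mul_inv_of_mul_eq (MulAut.ext_F2 ?_ ?_)) <;> simp [mul_assoc])
    (by
      rw [← map_inv, ← map_mul, ← map_mul, ← map_mul,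
        ← one_mul (π (twistX 1 * (invAut * swapAut))), ← hconj xg⁻¹, ← map_mul]
      refine congrArg π (mul_inv_eq_of_eq_mul (MulAut.ext_F2 ?_ ?_))
      · simp [-map_inv, mul_assoc]
      · simp only [MulAut.mul_apply, twistX_yg, twistY_yg, swapAut_xg, swapAut_yg, invAut_xg,
          invAut_yg, twistX_xg, map_mul, zpow_one, map_inv (twistX 1), MulAut.conj_apply]
        group) hγ
  rw [hK, hP] at h1
  obtain ⟨_, ⟨d, hd, rfl⟩, _, ⟨p, hp, rfl⟩, _, ⟨σ, hσ, rfl⟩, h⟩ := h1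
  rw [← map_mul, ← map_mul] at h
  obtain ⟨g, hg⟩ := QuotientGroup.eq.1 h.symm
  exact ⟨g, d, hd, p, hp, σ, hσ, by rw [hg, mul_inv_cancel_left]⟩

/-- Nielsen's theorem: an automorphism of `F₂` acting trivially on the abelianization is inner. -/
theorem exists_eq_conj_of_autMat_eq_one {γ : MulAut F2} (h : autMat γ = 1) :
    ∃ g, γ = MulAut.conj g := by
  obtain ⟨g, d, hd, p, hp, σ, hσ, rfl⟩ := exists_conj_mul_positive γ
  rw [autMat_mul, autMat_conj, mul_one, autMat_mul, autMat_mul] at h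
  have hτ := mul_mem (inv_mem hd) (inv_mem hσ)
  have h1 : autMat p = autMat (d⁻¹ * σ⁻¹) := by
    calc autMat p = autMat d⁻¹ * (autMat d * autMat p * autMat σ) * autMat σ⁻¹ := by
          simp only [← autMat_mul]; congr 1; group
      _ = autMat (d⁻¹ * σ⁻¹) := by rw [h, mul_one, autMat_mul]
  have h2 := autMat_signedPerm_col_sum_le hτ 0
  have h3 := autMat_signedPerm_col_sum_le hτ 1
  rw [← h1] at h2 h3
  obtain rfl : p = 1 := (autMat_positiveTwists hp).2.2.resolve_right (by omega)
  have h4 := eq_one_of_mem_signedPerms hτ (h1.symm.trans autMat_one)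
  rw [← mul_inv_rev, inv_eq_one] at h4
  have h5 : d * 1 * σ = 1 := by
    rw [mul_one, eq_inv_of_mul_eq_one_left h4, mul_inv_cancel]
  exact ⟨g, by rw [h5, one_mul]⟩

end Positive

section Veech

/-- The endomorphism `x ↦ x * z ^ k`, `y ↦ z ^ (-k) * x⁻¹ * z`, where `z = x * y`. -/
def twistXYHom (k : ℤ) : F2 →* F2 :=
  genHom (xg * (xg * yg) ^ k) ((xg * yg) ^ (-k) * xg⁻¹ * (xg * yg))

theorem twistXYHom_comp_neg (k : ℤ) :
    (twistXYHom (-k)).comp (twistXYHom k) = MonoidHom.id F2 := by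
  have hz : twistXYHom (-k) (xg * yg) = xg * yg := by
    rw [map_mul, twistXYHom, genHom_xg, genHom_yg]; group
  refine MonoidHom.ext_F2 ?_ ?_
  · rw [MonoidHom.comp_apply, twistXYHom.eq_def k, genHom_xg, map_mul, map_zpow, hz, twistXYHom,
      genHom_xg, MonoidHom.id_apply]
    group
  · rw [MonoidHom.comp_apply, twistXYHom.eq_def k, genHom_yg, map_mul, map_mul, map_zpow, hz,
      map_inv, twistXYHom, genHom_xg, MonoidHom.id_apply]
    group

/-- The automorphism `x ↦ x * z ^ k`, `y ↦ z ^ (-k) * x⁻¹ * z`, where `z = x * y`; it fixes `z`. -/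
def twistXY (k : ℤ) : MulAut F2 :=
  MonoidHom.toMulEquiv (twistXYHom k) (twistXYHom (-k)) (twistXYHom_comp_neg k)
    (by simpa using twistXYHom_comp_neg (-k))

@[simp] theorem twistXY_xg (k : ℤ) : twistXY k xg = xg * (xg * yg) ^ k := genHom_xg _ _
@[simp] theorem twistXY_yg (k : ℤ) :
    twistXY k yg = (xg * yg) ^ (-k) * xg⁻¹ * (xg * yg) := genHom_yg _ _

theorem autMat_twistXY (k : ℤ) : autMat (twistXY k) = !![1 + k, -k; k, 1 - k] := by
  have hx := twistXY_xg k
  have hy := twistXY_yg k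
  simp only [xg, yg] at hx hy
  ext i j
  fin_cases i <;> fin_cases j <;> simp [autMat, hx, hy, expSum_of]
  ring

theorem mul_mem_StabSet {V : Subgroup F2} {γ δ : MulAut F2} (hγ : γ ∈ StabSet V)
    (hδ : δ ∈ StabSet V) : γ * δ ∈ StabSet V := by
  refine ⟨by rw [autMat_mul, Matrix.det_mul, hγ.1, hδ.1, one_mul], ?_⟩
  have h : (γ * δ : F2 ≃* F2).toMonoidHom = γ.toMonoidHom.comp δ.toMonoidHom := rfl
  rw [h, ← Subgroup.map_map, hδ.2, hγ.2]

theorem mem_StabSet_comap {H : Type*} [Group H] {φ : F2 →* H} (S : Subgroup H) {γ : MulAut F2}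
    (hdet : (autMat γ).det = 1) (h : ∀ w, φ (γ w) = φ w) : γ ∈ StabSet (S.comap φ) := by
  refine ⟨hdet, le_antisymm ?_ fun w hw => ⟨γ.symm w, ?_, γ.apply_symm_apply w⟩⟩
  · rintro _ ⟨w, hw, rfl⟩
    change φ (γ w) ∈ S
    rwa [h]
  · change φ (γ.symm w) ∈ S
    rwa [← h, MulEquiv.apply_symm_apply]

section Invariance

variable {H : Type*} [Group H] {φ : F2 →* H}

theorem apply_aut_eq {γ : MulAut F2} (hx : φ (γ xg) = φ xg) (hy : φ (γ yg) = φ yg) (w : F2) :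
    φ (γ w) = φ w :=
  DFunLike.congr_fun
    (MonoidHom.ext_F2 (f := φ.comp (γ : F2 ≃* F2).toMonoidHom) (g := φ) hx hy) w

theorem apply_twistX {k : ℤ} (h : φ xg ^ k = 1) (w : F2) : φ (twistX k w) = φ w :=
  apply_aut_eq (by simp) (by simp [h]) w

theorem apply_twistY {k : ℤ} (h : φ yg ^ k = 1) (w : F2) : φ (twistY k w) = φ w :=
  apply_aut_eq (by simp [h]) (by simp) w

theorem apply_twistXY {k : ℤ} (h : φ (xg * yg) ^ k = 1) (w : F2) : φ (twistXY k w) = φ w := by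
  rw [map_mul] at h
  exact apply_aut_eq (by simp [h]) (by simp [h]) w

end Invariance

theorem exists_pow_mul_self_eq {M : Type*} [Monoid M] [Finite M] (a : M) :
    ∃ N ≠ 0, a ^ N * a ^ N = a ^ N := by
  obtain ⟨i, j, hij, h⟩ := Finite.exists_ne_map_eq_of_infinite fun i : ℕ => a ^ i
  wlog hlt : i < j generalizing i j
  · exact this j i hij.symm h.symm (by omega)
  obtain ⟨r, rfl⟩ := Nat.exists_eq_add_of_lt hlt
  have hper : ∀ t s, i ≤ s → a ^ (s + (r + 1) * t) = a ^ s := by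
    intro t
    induction t with
    | zero => simp
    | succ t ih =>
      intro s hs
      obtain ⟨u, rfl⟩ := Nat.exists_eq_add_of_le hs
      rw [← ih _ hs, show i + u + (r + 1) * (t + 1) = i + r + 1 + (u + (r + 1) * t) by ring,
        pow_add, ← h, ← pow_add, add_assoc]
  refine ⟨(r + 1) * (i + 1), by positivity, ?_⟩
  rw [← pow_add, hper _ _ (by nlinarith)]

/-- If `q` is coprime to `p` then `1 - p ^ N` is congruent to a multiple of `q` modulo every `n`
for which `p ^ N` is idempotent modulo `n`. -/
theorem exists_dvd_and_modEq {p q : ℕ} (h : Nat.Coprime p q) {n : ℕ} {N : ℕ}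
    (hN : ((p : ZMod n) ^ N) * (p : ZMod n) ^ N = (p : ZMod n) ^ N) :
    ∃ l : ℤ, (q : ℤ) ∣ l ∧ (l : ZMod n) = 1 - (p : ZMod n) ^ N := by
  have h1 : (n : ℤ) ∣ (p : ℤ) ^ N * (1 - (p : ℤ) ^ N) := by
    rw [← ZMod.intCast_zmod_eq_zero_iff_dvd]
    push_cast
    rw [mul_sub, hN, mul_one, sub_self]
  have h2 : IsCoprime ((Int.gcd q n : ℕ) : ℤ) ((p : ℤ) ^ N) := by
    refine IsCoprime.pow_right ?_
    exact IsCoprime.of_isCoprime_of_dvd_left (Nat.isCoprime_iff_coprime.2 h.symm)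
      (Int.gcd_dvd_left _ _)
  obtain ⟨c, hc⟩ := h2.dvd_of_dvd_mul_left ((Int.gcd_dvd_right _ _).trans h1)
  refine ⟨q * (Int.gcdA q n * c), dvd_mul_right _ _, ?_⟩
  have h3 : (1 : ZMod n) - (p : ZMod n) ^ N = ((1 - (p : ℤ) ^ N : ℤ) : ZMod n) := by push_cast; rfl
  rw [h3, hc, Int.gcd_eq_gcd_ab]
  push_cast
  rw [ZMod.natCast_self]
  ring

theorem exists_mem_StabSet_autMat_eq {H : Type*} [Group H] {φ : F2 →* H} (S : Subgroup H)
    {p q d : ℕ} (hx : φ xg ^ p = 1) (hy : φ yg ^ q = 1) (hxy : φ (xg * yg) ^ d = 1)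
    (hpq : Nat.Coprime p q) (hpd : Nat.Coprime p d)
    (hV : IsCongruenceSet (VeechGroup (S.comap φ))) :
    ∃ γ ∈ StabSet (S.comap φ), autMat γ = autMat (twistX 1) := by
  obtain ⟨n, hn, hΓ⟩ := hV
  have : NeZero n := ⟨by omega⟩
  obtain ⟨N, hN0, hN⟩ := exists_pow_mul_self_eq (p : ZMod n)
  obtain ⟨l, ⟨l', rfl⟩, hl⟩ := exists_dvd_and_modEq hpq hN
  obtain ⟨w, ⟨w', rfl⟩, hw⟩ := exists_dvd_and_modEq hpd hN
  have hxk : φ xg ^ ((p : ℤ) ^ N) = 1 := by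
    obtain ⟨M, rfl⟩ := Nat.exists_eq_succ_of_ne_zero hN0
    rw [pow_succ', zpow_mul, zpow_natCast, hx, one_zpow]
  have hyk : ∀ m : ℤ, φ yg ^ (q * m : ℤ) = 1 := fun m => by
    rw [zpow_mul, zpow_natCast, hy, one_zpow]
  have hxyk : φ (xg * yg) ^ (-(d * w') : ℤ) = 1 := by
    rw [zpow_neg, zpow_mul, zpow_natCast, hxy, one_zpow, inv_one]
  set k : ℤ := (p : ℤ) ^ N with hk
  set P : MulAut F2 := twistX k * (twistY (q * -l') * (twistXY (-(d * w')) * twistY (q * l')))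
    with hP
  have hPmat : autMat P = !![1, k; 0, 1] * (!![1, 0; q * -l', 1] *
      (!![1 + -(d * w'), -(-(d * w')); -(d * w'), 1 - -(d * w')] * !![1, 0; q * l', 1])) := by
    simp only [hP, autMat_mul, autMat_twistX, autMat_twistY, autMat_twistXY]
  have hPdet : (autMat P).det = 1 := by
    simp only [hPmat, Matrix.det_mul, Matrix.det_fin_two_of]
    ring
  have hPS : P ∈ StabSet (S.comap φ) := mem_StabSet_comap S hPdet fun w => by
    simp only [hP, MulAut.mul_apply]
    rw [apply_twistX hxk, apply_twistY (hyk _), apply_twistXY hxyk, apply_twistY (hyk _)]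
  have hTdet : (autMat (twistX 1)).det = 1 := by simp [autMat_twistX]
  let A : SL2Z := ⟨autMat P, hPdet⟩
  let T : SL2Z := ⟨autMat (twistX 1), hTdet⟩
  have hAT : A⁻¹ * T ∈ CongruenceSubgroup.Gamma n := by
    rw [CongruenceSubgroup.Gamma_mem', map_mul, map_inv, inv_mul_eq_one]
    have hk' : (k : ZMod n) = (p : ZMod n) ^ N := by push_cast [hk]; rfl
    rw [← hk'] at hl hw hN
    push_cast at hl hw
    ext i j
    change ((autMat P i j : ℤ) : ZMod n) = ((autMat (twistX 1) i j : ℤ) : ZMod n)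
    rw [hPmat, autMat_twistX]
    fin_cases i <;> fin_cases j <;>
      simp [Matrix.mul_apply, Fin.sum_univ_two, hl, hw]
    · linear_combination (1 + (k : ZMod n) ^ 2) * hN
    · linear_combination (-(k : ZMod n)) * hN
    · linear_combination (k : ZMod n) * hN
    · linear_combination -hN
  obtain ⟨δ, hδ, hδmat⟩ := hΓ hAT
  refine ⟨P * δ, mul_mem_StabSet hPS hδ, ?_⟩
  rw [autMat_mul, ← hδmat]
  exact congrArg Subtype.val (mul_inv_cancel_left A T)

theorem not_isCongruenceSet_VeechGroup {X : Type*} {φ : F2 →* Equiv.Perm X} {z : X}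
    (htrans : ∀ r, ∃ h, φ h z = r) {p q d : ℕ} (hx : φ xg ^ p = 1) (hy : φ yg ^ q = 1)
    (hxy : φ (xg * yg) ^ d = 1) (hpq : Nat.Coprime p q) (hpd : Nat.Coprime p d)
    (hne : φ (xg * yg) ^ q ≠ 1) :
    ¬ IsCongruenceSet
      (VeechGroup ((MulAction.stabilizer (Equiv.Perm X) z).comap φ)) := by
  intro hV
  obtain ⟨γ, ⟨-, hγ⟩, hmat⟩ := exists_mem_StabSet_autMat_eq _ hx hy hxy hpq hpd hV
  obtain ⟨g, hg⟩ := exists_eq_conj_of_autMat_eq_one (γ := γ * (twistX 1)⁻¹) (by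
    rw [autMat_mul, hmat, ← autMat_mul, mul_inv_cancel, autMat_one])
  rw [mul_inv_eq_iff_eq_mul] at hg
  have hker : ∀ w, φ w = 1 → φ (γ w) = 1 := by
    intro w hw
    ext r
    obtain ⟨h, rfl⟩ := htrans r
    have h1 : γ.symm h⁻¹ * w * γ.symm h ∈ (MulAction.stabilizer (Equiv.Perm X) z).comap φ := by
      rw [Subgroup.mem_comap, map_mul, map_mul, hw, mul_one, ← map_mul, map_inv, inv_mul_cancel,
        map_one]
      exact one_mem _
    have h2 := Subgroup.mem_map_of_mem γ.toMonoidHom h1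
    rw [hγ] at h2
    have h3 : γ.toMonoidHom (γ.symm h⁻¹ * w * γ.symm h) = h⁻¹ * γ w * h := by simp
    rw [h3, Subgroup.mem_comap, MulAction.mem_stabilizer_iff, Equiv.Perm.smul_def, map_mul,
      map_mul, map_inv, Equiv.Perm.mul_apply, Equiv.Perm.mul_apply, Equiv.Perm.inv_eq_iff_eq] at h2
    simpa using h2
  have h1 := hker (yg ^ q) (by rw [map_pow, hy])
  rw [hg, MulAut.mul_apply, map_pow, twistX_yg, zpow_one, MulAut.conj_apply, map_mul, map_mul,
    map_inv, mul_inv_eq_one, mul_eq_left, map_pow] at h1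
  exact hne h1

end Veech

section Origami

/-- The permutation of `Fin d` given by a map of order three on the natural numbers. -/
def cubePerm (d : ℕ) (f : ℕ → ℕ) (hd : ∀ i < d, f i < d) (h : ∀ i, f (f (f i)) = i) :
    Equiv.Perm (Fin d) where
  toFun i := ⟨f i, hd i i.2⟩
  invFun i := ⟨f (f i), hd _ (hd i i.2)⟩
  left_inv i := Fin.ext (h i)
  right_inv i := Fin.ext (h i)

theorem cubePerm_pow_three {d : ℕ} {f : ℕ → ℕ} (hd : ∀ i < d, f i < d)
    (h : ∀ i, f (f (f i)) = i) : cubePerm d f hd h ^ 3 = 1 :=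
  Equiv.ext fun i => Fin.ext (h i)

/-- On each block `4 * j, …, 4 * j + 3` with `j < m`: the three-cycle of the first three elements. -/
def blockCycle (m i : ℕ) : ℕ :=
  if i < 4 * m then if i % 4 = 3 then i else if i % 4 = 2 then i - 2 else i + 1 else i

/-- On each block `4 * j, …, 4 * j + 3` with `j < m`: the three-cycle omitting `4 * j + 2`. -/
def blockCommutator (m i : ℕ) : ℕ :=
  if i < 4 * m then
    if i % 4 = 0 then i + 3 else if i % 4 = 1 then i - 1 else if i % 4 = 3 then i - 2 else i
  else i

section Blocks

variable {m i : ℕ}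

theorem blockCycle_of_le (h : 4 * m ≤ i) : blockCycle m i = i := if_neg (by omega)

theorem blockCommutator_of_le (h : 4 * m ≤ i) : blockCommutator m i = i := if_neg (by omega)

theorem blockCycle_mul (h : i < m) : blockCycle m (4 * i) = 4 * i + 1 := by
  rw [blockCycle, if_pos (by omega), if_neg (by omega), if_neg (by omega)]

theorem blockCycle_mul_add_one (h : i < m) : blockCycle m (4 * i + 1) = 4 * i + 2 := by
  rw [blockCycle, if_pos (by omega), if_neg (by omega), if_neg (by omega)]

theorem blockCycle_mul_add_two (h : i < m) : blockCycle m (4 * i + 2) = 4 * i := by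
  rw [blockCycle, if_pos (by omega), if_neg (by omega), if_pos (by omega), Nat.add_sub_cancel]

theorem blockCycle_mul_add_three (h : i < m) : blockCycle m (4 * i + 3) = 4 * i + 3 := by
  rw [blockCycle, if_pos (by omega), if_pos (by omega)]

theorem blockCommutator_mul (h : i < m) : blockCommutator m (4 * i) = 4 * i + 3 := by
  rw [blockCommutator, if_pos (by omega), if_pos (by omega)]

theorem blockCommutator_mul_add_one (h : i < m) : blockCommutator m (4 * i + 1) = 4 * i := by
  rw [blockCommutator, if_pos (by omega), if_neg (by omega), if_pos (by omega), Nat.add_sub_cancel]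

theorem blockCommutator_mul_add_two (h : i < m) : blockCommutator m (4 * i + 2) = 4 * i + 2 := by
  rw [blockCommutator, if_pos (by omega), if_neg (by omega), if_neg (by omega), if_neg (by omega)]

theorem blockCommutator_mul_add_three (h : i < m) :
    blockCommutator m (4 * i + 3) = 4 * i + 1 := by
  rw [blockCommutator, if_pos (by omega), if_neg (by omega), if_neg (by omega), if_pos (by omega)]
  rfl

theorem le_or_exists_block (m i : ℕ) :
    4 * m ≤ i ∨ ∃ j < m, i = 4 * j ∨ i = 4 * j + 1 ∨ i = 4 * j + 2 ∨ i = 4 * j + 3 :=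
  or_iff_not_imp_left.2 fun _ => ⟨i / 4, by omega, by omega⟩

theorem blockCycle_three (m i : ℕ) : blockCycle m (blockCycle m (blockCycle m i)) = i := by
  obtain h | ⟨j, h, rfl | rfl | rfl | rfl⟩ := le_or_exists_block m i
  · simp only [blockCycle_of_le h]
  all_goals
    simp only [blockCycle_mul h, blockCycle_mul_add_one h, blockCycle_mul_add_two h,
      blockCycle_mul_add_three h]

theorem blockCommutator_three (m i : ℕ) :
    blockCommutator m (blockCommutator m (blockCommutator m i)) = i := by
  obtain h | ⟨j, h, rfl | rfl | rfl | rfl⟩ := le_or_exists_block m i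
  · simp only [blockCommutator_of_le h]
  all_goals
    simp only [blockCommutator_mul h, blockCommutator_mul_add_one h,
      blockCommutator_mul_add_two h, blockCommutator_mul_add_three h]

theorem blockCycle_succ_eq (hi : i < 8 * m + 1) :
    (if blockCycle m i = 8 * m then 0 else blockCycle m i + 1) =
      blockCommutator m (blockCycle m (if i = 8 * m then 0 else i + 1)) := by
  obtain h | ⟨j, h, rfl | rfl | rfl | rfl⟩ := le_or_exists_block m i
  · rw [blockCycle_of_le h]
    split_ifs with h'
    · rcases Nat.eq_zero_or_pos m with rfl | hm
      · rfl
      · exact (congrArg _ (blockCycle_mul hm)).trans (blockCommutator_mul_add_one hm) |>.symm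
    · rw [blockCycle_of_le (by omega), blockCommutator_of_le (by omega)]
  · rw [blockCycle_mul h, if_neg (by omega), if_neg (by omega), blockCycle_mul_add_one h,
      blockCommutator_mul_add_two h]
  · rw [blockCycle_mul_add_one h, if_neg (by omega), if_neg (by omega),
      blockCycle_mul_add_two h, blockCommutator_mul h]
  · rw [blockCycle_mul_add_two h, if_neg (by omega), if_neg (by omega),
      blockCycle_mul_add_three h, blockCommutator_mul_add_three h]
  · rw [blockCycle_mul_add_three h, if_neg (by omega)]
    rcases (Nat.succ_le_of_lt h).eq_or_lt with h' | h'
    · rw [blockCycle_of_le (by omega), blockCommutator_of_le (by omega)]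
    · exact (congrArg _ (blockCycle_mul h')).trans (blockCommutator_mul_add_one h') |>.symm

end Blocks

variable (m : ℕ)

/-- The long cycle of the origami. -/
def longCycle : Equiv.Perm (Fin (8 * m + 1)) := Equiv.addRight 1

/-- The vertical permutation of the origami. -/
def vertPerm : Equiv.Perm (Fin (8 * m + 1)) :=
  cubePerm _ (blockCycle m) (fun i hi => by unfold blockCycle; split_ifs <;> omega)
    (blockCycle_three m)

/-- The commutator of the origami. -/
def commPerm : Equiv.Perm (Fin (8 * m + 1)) :=
  cubePerm _ (blockCommutator m) (fun i hi => by unfold blockCommutator; split_ifs <;> omega)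
    (blockCommutator_three m)

/-- The horizontal permutation of the origami. -/
def horPerm : Equiv.Perm (Fin (8 * m + 1)) := longCycle m * (vertPerm m)⁻¹

theorem val_longCycle (i : Fin (8 * m + 1)) :
    (longCycle m i : ℕ) = if (i : ℕ) = 8 * m then 0 else (i : ℕ) + 1 := by
  rw [longCycle, Equiv.coe_addRight, Fin.val_add_one]
  simp only [Fin.ext_iff, Fin.val_last]

theorem val_vertPerm (i : Fin (8 * m + 1)) : (vertPerm m i : ℕ) = blockCycle m i := rfl

theorem val_commPerm (i : Fin (8 * m + 1)) : (commPerm m i : ℕ) = blockCommutator m i := rfl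

theorem val_horPerm (i : Fin (8 * m + 1)) :
    (horPerm m i : ℕ) = if blockCycle m (blockCycle m i) = 8 * m then 0
      else blockCycle m (blockCycle m i) + 1 :=
  val_longCycle m _

theorem horPerm_mul_vertPerm : horPerm m * vertPerm m = longCycle m := by simp [horPerm]

theorem vertPerm_pow_three : vertPerm m ^ 3 = 1 := cubePerm_pow_three _ _

theorem commPerm_pow_three : commPerm m ^ 3 = 1 := cubePerm_pow_three _ _

theorem longCycle_pow_val_zero (i : Fin (8 * m + 1)) : (longCycle m ^ (i : ℕ)) 0 = i := by
  obtain ⟨k, hk⟩ := i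
  refine Fin.ext ?_
  induction k with
  | zero => simp
  | succ k ih =>
    simp only at ih ⊢
    rw [pow_succ', Equiv.Perm.mul_apply, val_longCycle, ih (by omega), if_neg (by omega)]

theorem longCycle_pow_eq_one : longCycle m ^ (8 * m + 1) = 1 := by
  have h0 : (longCycle m ^ (8 * m + 1)) 0 = 0 := by
    refine Fin.ext ?_
    have h := congrArg Fin.val (longCycle_pow_val_zero m (Fin.last (8 * m)))
    rw [Fin.val_last] at h
    rw [pow_succ', Equiv.Perm.mul_apply, val_longCycle, if_pos h, Fin.val_zero]
  ext1 i
  rw [← longCycle_pow_val_zero m i, ← Equiv.Perm.mul_apply, (Commute.pow_pow_self _ _ _).eq,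
    Equiv.Perm.mul_apply, h0, Equiv.Perm.one_apply]

theorem longCycle_pow_three_ne_one (hm : 1 ≤ m) : longCycle m ^ 3 ≠ 1 := by
  intro h
  have h1 := congrArg Fin.val (longCycle_pow_val_zero m ⟨3, by omega⟩)
  simp [h] at h1

theorem commutator_eq :
    horPerm m * vertPerm m * (horPerm m)⁻¹ * (vertPerm m)⁻¹ = commPerm m := by
  have h : longCycle m * vertPerm m = commPerm m * (vertPerm m * longCycle m) := by
    ext n
    simp only [Equiv.Perm.mul_apply, val_longCycle, val_vertPerm, val_commPerm]
    exact blockCycle_succ_eq n.2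
  rw [horPerm_mul_vertPerm, horPerm]
  calc _ = longCycle m * vertPerm m * (longCycle m)⁻¹ * (vertPerm m)⁻¹ := by group
    _ = commPerm m := by rw [h]; group

/-- The long cycle of the horizontal permutation. -/
def horOrbit (k : ℕ) : ℕ := if k < 2 * m then 4 * (k / 2) + 3 * (k % 2) else k + 2 * m

theorem val_horPerm_pow_zero {k : ℕ} (hk : k ≤ 6 * m) :
    ((horPerm m ^ k) 0 : ℕ) = horOrbit m k := by
  induction k with
  | zero => simp [horOrbit]
  | succ k ih =>
    rw [pow_succ', Equiv.Perm.mul_apply, val_horPerm, ih (by omega)]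
    by_cases hk' : k < 2 * m
    · obtain ⟨j, rfl | rfl⟩ := Nat.even_or_odd' k
      · rw [show horOrbit m (2 * j) = 4 * j by unfold horOrbit; split_ifs; omega,
          blockCycle_mul (by omega), blockCycle_mul_add_one (by omega), if_neg (by omega)]
        unfold horOrbit
        split_ifs <;> omega
      · rw [show horOrbit m (2 * j + 1) = 4 * j + 3 by unfold horOrbit; split_ifs; omega,
          blockCycle_mul_add_three (by omega), blockCycle_mul_add_three (by omega),
          if_neg (by omega)]
        unfold horOrbit
        split_ifs <;> omega
    · rw [show horOrbit m k = k + 2 * m from if_neg hk',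
        blockCycle_of_le (i := k + 2 * m) (by omega), blockCycle_of_le (by omega),
        if_neg (by omega), horOrbit, if_neg (by omega)]
      ring

theorem horPerm_pow_eq_one : horPerm m ^ (6 * m + 1) = 1 := by
  have h0 : (horPerm m ^ (6 * m + 1)) 0 = 0 := by
    refine Fin.ext ?_
    rw [pow_succ', Equiv.Perm.mul_apply, val_horPerm, val_horPerm_pow_zero m le_rfl, Fin.val_zero]
    rw [show horOrbit m (6 * m) = 8 * m by unfold horOrbit; split_ifs <;> omega,
      blockCycle_of_le (i := 8 * m) (by omega), blockCycle_of_le (by omega), if_pos rfl]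
  ext1 i
  rw [Equiv.Perm.one_apply]
  have hi := i.2
  have key : horPerm m i = i ∨ ∃ k ≤ 6 * m, horOrbit m k = i := by
    obtain h | ⟨j, h, hj | hj | hj | hj⟩ := le_or_exists_block m i
    · refine Or.inr ⟨i - 2 * m, by omega, ?_⟩
      unfold horOrbit
      split_ifs <;> omega
    · refine Or.inr ⟨2 * j, by omega, ?_⟩
      unfold horOrbit
      split_ifs <;> omega
    · refine Or.inl (Fin.ext ?_)
      rw [val_horPerm, hj, blockCycle_mul_add_one h, blockCycle_mul_add_two h, if_neg (by omega)]
    · refine Or.inl (Fin.ext ?_)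
      rw [val_horPerm, hj, blockCycle_mul_add_two h, blockCycle_mul h, if_neg (by omega)]
    · refine Or.inr ⟨2 * j + 1, by omega, ?_⟩
      unfold horOrbit
      split_ifs <;> omega
  obtain h | ⟨k, hk, h⟩ := key
  · exact Equiv.Perm.pow_apply_eq_self_of_apply_eq_self h _
  · obtain rfl : (horPerm m ^ k) 0 = i := Fin.ext ((val_horPerm_pow_zero m hk).trans h)
    rw [← Equiv.Perm.mul_apply, (Commute.pow_pow_self _ _ _).eq, Equiv.Perm.mul_apply, h0]

theorem card_support_commPerm : (commPerm m).support.card = 3 * m := by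
  have h1 : (commPerm m).support.card =
      ((Finset.range (4 * m)).filter fun i => i % 4 ≠ 2).card := by
    refine Finset.card_bij (fun i _ => (i : ℕ)) ?_ (fun _ _ _ _ h => Fin.ext h) ?_
    · intro i hi
      rw [Equiv.Perm.mem_support, Ne, Fin.ext_iff, val_commPerm] at hi
      rw [Finset.mem_filter, Finset.mem_range]
      unfold blockCommutator at hi
      split_ifs at hi <;> omega
    · intro i hi
      rw [Finset.mem_filter, Finset.mem_range] at hi
      refine ⟨⟨i, by omega⟩, ?_, rfl⟩
      rw [Equiv.Perm.mem_support, Ne, Fin.ext_iff, val_commPerm]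
      simp only [blockCommutator]
      split_ifs <;> omega
  rw [h1, Finset.card_filter]
  clear h1
  induction m with
  | zero => rfl
  | succ m ih =>
    rw [show 4 * (m + 1) = 4 * m + 1 + 1 + 1 + 1 by ring]
    simp only [Finset.sum_range_succ, ih]
    split_ifs <;> omega

theorem card_cycles_commPerm :
    (commPerm m).cycleType.card + (Finset.univ.filter fun z => commPerm m z = z).card = 6 * m + 1 := by
  have : Fact (Nat.Prime 3) := ⟨Nat.prime_three⟩
  have h1 := Equiv.Perm.sum_cycleType (commPerm m)
  rw [Equiv.Perm.cycleType_of_pow_prime_eq_one (p := 3) (commPerm_pow_three m),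
    Multiset.sum_replicate, card_support_commPerm, smul_eq_mul] at h1
  have h2 := Finset.card_filter_add_card_filter_not (s := Finset.univ) fun z => commPerm m z = z
  have h3 : (Finset.univ.filter fun z => ¬ commPerm m z = z) = (commPerm m).support := by
    ext z; simp
  rw [h3, card_support_commPerm, Finset.card_univ, Fintype.card_fin] at h2
  omega

end Origami

/-- For every `g ≥ 2` there is an origami, given by a pair of permutations `(σa, σb)` of a
`d`-element set generating a transitive subgroup, whose closed surface has genus `g`
(i.e. `d - c = 2g - 2` where `c` is the number of cycles, counting fixed points, of the
commutator), and whose Veech group is not a congruence subgroup of `SL₂(ℤ)`. -/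
theorem origami_noncongruence_in_each_genus (g : ℕ) (hg : 2 ≤ g) :
    ∃ (d : ℕ) (hd : 1 ≤ d) (σa σb : Equiv.Perm (Fin d)),
      (∀ i j : Fin d,
        ∃ p ∈ Subgroup.closure ({σa, σb} : Set (Equiv.Perm (Fin d))), p i = j) ∧
      ((d : ℤ) -
          ((σa * σb * σa⁻¹ * σb⁻¹).cycleType.card +
            (Finset.univ.filter fun z : Fin d => (σa * σb * σa⁻¹ * σb⁻¹) z = z).card : ℕ)
        = 2 * g - 2) ∧
      ¬ IsCongruenceSet (VeechGroup
        (Subgroup.comap (FreeGroup.lift fun i : Fin 2 => if i = 0 then σa else σb)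
          (MulAction.stabilizer (Equiv.Perm (Fin d)) (⟨0, hd⟩ : Fin d)))) := by
  obtain ⟨m, rfl⟩ : ∃ m, g = m + 1 := ⟨g - 1, by omega⟩
  have hm : 1 ≤ m := by omega
  refine ⟨8 * m + 1, by omega, horPerm m, vertPerm m, fun i j => ?_, ?_, ?_⟩
  · have hc : longCycle m ∈ Subgroup.closure {horPerm m, vertPerm m} := by
      rw [← horPerm_mul_vertPerm]
      exact mul_mem (Subgroup.subset_closure (by simp)) (Subgroup.subset_closure (by simp))
    refine ⟨longCycle m ^ (j : ℕ) * (longCycle m ^ (i : ℕ))⁻¹,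
      mul_mem (pow_mem hc _) (inv_mem (pow_mem hc _)), ?_⟩
    rw [Equiv.Perm.mul_apply, Equiv.Perm.inv_eq_iff_eq.2 (longCycle_pow_val_zero m i).symm,
      longCycle_pow_val_zero]
  · rw [commutator_eq, card_cycles_commPerm]
    push_cast
    ring
  · set φ : F2 →* Equiv.Perm (Fin (8 * m + 1)) :=
      FreeGroup.lift fun i : Fin 2 => if i = 0 then horPerm m else vertPerm m with hφ
    have hx : φ xg = horPerm m := by simp [hφ, xg]
    have hy : φ yg = vertPerm m := by simp [hφ, yg]
    have hxy : φ (xg * yg) = longCycle m := by rw [map_mul, hx, hy, horPerm_mul_vertPerm]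
    refine not_isCongruenceSet_VeechGroup (p := 6 * m + 1) (q := 3) (d := 8 * m + 1) (fun r => ?_)
      (by rw [hx, horPerm_pow_eq_one]) (by rw [hy, vertPerm_pow_three])
      (by rw [hxy, longCycle_pow_eq_one]) ?_ ?_
      (by rw [hxy]; exact longCycle_pow_three_ne_one m hm)
    · exact ⟨(xg * yg) ^ (r : ℕ), by
        rw [map_pow, hxy]
        exact longCycle_pow_val_zero m r⟩
    · rw [show 6 * m + 1 = 1 + 3 * (2 * m) by ring, Nat.coprime_add_mul_left_left]
      exact Nat.coprime_one_left 3
    · rw [show 8 * m + 1 = 2 * m + (6 * m + 1) by ring, Nat.coprime_add_self_right,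
        show 6 * m + 1 = 1 + 2 * m * 3 by ring, Nat.coprime_add_mul_left_left]
      exact Nat.coprime_one_left _
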